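/- The Wise group G, given by the presentation ⟨a, b, c, s, t ∣ c = ab, ab = ba, c² = s a s⁻¹, c² = t b t⁻¹⟩, has the property of rapid decay relative to the word length ℓ associated to this presentation: there exists a polynomial P with real coefficients such that for every real r ≥ 0 and all finitely supported functions f, g : G → ℂ with supp(f) ⊆ B_r = {x ∈ G : ℓ(x) ≤ r}, one has ‖f * g‖₂ ≤ P(r) · ‖f‖₂ · ‖g‖₂. -/

import Mathlib

/-! The Wise group `G = ⟨a, b, c, s, t ∣ c = ab, ab = ba, c² = s a s⁻¹, c² = t b t⁻¹⟩`
has the property of rapid decay relative to the word length associated to this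
presentation. -/

/-- The five generators of Wise's group. -/
inductive WiseGen | a | b | c | s | t
  deriving DecidableEq

open FreeGroup in
/-- The relators of Wise's presentation: `c = ab`, `ab = ba`, `c² = s a s⁻¹`,
`c² = t b t⁻¹`. -/
def wiseRels : Set (FreeGroup WiseGen) :=
  { of WiseGen.c * (of WiseGen.a * of WiseGen.b)⁻¹,
    (of WiseGen.a * of WiseGen.b) * (of WiseGen.b * of WiseGen.a)⁻¹,
    (of WiseGen.c * of WiseGen.c) * (of WiseGen.s * of WiseGen.a * (of WiseGen.s)⁻¹)⁻¹,
    (of WiseGen.c * of WiseGen.c) * (of WiseGen.t * of WiseGen.b * (of WiseGen.t)⁻¹)⁻¹ }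

/-- Wise's group, given by the presentation
`⟨a, b, c, s, t ∣ c = ab, ab = ba, c² = s a s⁻¹, c² = t b t⁻¹⟩`. -/
abbrev WiseGroup := PresentedGroup wiseRels

/-- The images in `WiseGroup` of the five generators. -/
def wiseGenSet : Set WiseGroup := Set.range (PresentedGroup.of (rels := wiseRels))

/-- The word length on the Wise group relative to the generators `a, b, c, s, t`
and their inverses: the least `n` such that `x` is a product of `n` generators
or inverses of generators. -/
noncomputable def wiseWordLength (x : WiseGroup) : ℕ :=
  sInf {n | ∃ w : List WiseGroup, w.length = n ∧
    (∀ g ∈ w, g ∈ wiseGenSet ∨ g⁻¹ ∈ wiseGenSet) ∧ w.prod = x}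

/-- The `ℓ²`-norm of a function on the Wise group. -/
noncomputable def l2norm (h : WiseGroup → ℂ) : ℝ :=
  Real.sqrt (∑' x, ‖h x‖ ^ 2)

/-- The convolution of two finitely supported functions on the Wise group:
`(f * g)(x) = Σ_y f(y) g(y⁻¹ x)`. -/
noncomputable def conv (f g : WiseGroup →₀ ℂ) : WiseGroup → ℂ :=
  fun x => ∑ y ∈ f.support, f y * g (y⁻¹ * x)

namespace SimpleGraph

variable {V : Type*} {Γ : SimpleGraph V}

/-- A vertex lies between `u` and `v` if every walk from `u` to `v` visits it. -/
def Between (Γ : SimpleGraph V) (u v x : V) : Prop :=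
  ∀ p : Γ.Walk u v, x ∈ p.support

theorem IsAcyclic.between_of_mem_support (hΓ : Γ.IsAcyclic) {u v x : V} {p : Γ.Walk u v}
    (hp : p.IsPath) (hx : x ∈ p.support) : Γ.Between u v x := by
  classical
  intro q
  have := congrArg Subtype.val ((hΓ.subsingleton_path u v).elim ⟨p, hp⟩ q.toPath)
  rw [show p = q.bypass from this] at hx
  exact q.support_bypass_subset_support hx

theorem Walk.exists_isPath_through_common_vertex {u v w : V} (p : Γ.Walk u v) (hp : p.IsPath)
    (q : Γ.Walk v w) (hq : q.IsPath) :
    ∃ (x : V) (r : Γ.Walk u w), r.IsPath ∧ x ∈ p.support ∧ x ∈ q.support ∧ x ∈ r.support ∧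
      ∀ y ∈ r.support, y ∈ p.support ∨ y ∈ q.support := by
  classical
  induction p with
  | @nil u => exact ⟨u, q, hq, by simp, by simp, by simp, fun y hy => Or.inr hy⟩
  | @cons u u' v h p ih =>
    by_cases hu : u ∈ q.support
    · exact ⟨u, q.dropUntil u hu, hq.dropUntil hu, by simp, hu, by simp,
        fun y hy => Or.inr (q.support_dropUntil_subset_support hu hy)⟩
    · rw [Walk.cons_isPath_iff] at hp
      obtain ⟨x, r, hr, hxp, hxq, hxr, hsub⟩ := ih hp.1 q hq
      have hur : u ∉ r.support := fun hmem => (hsub u hmem).elim hp.2 hu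
      refine ⟨x, .cons h r, hr.cons hur, by simp [hxp], hxq, by simp [hxr], fun y hy => ?_⟩
      rw [Walk.support_cons, List.mem_cons] at hy
      rcases hy with rfl | hy
      · simp
      · rcases hsub y hy with h' | h' <;> simp [h']

theorem IsAcyclic.exists_median (hΓ : Γ.IsAcyclic) {u v w : V} (huv : Γ.Reachable u v)
    (hvw : Γ.Reachable v w) :
    ∃ x, Γ.Between u v x ∧ Γ.Between v w x ∧ Γ.Between u w x := by
  obtain ⟨p, hp⟩ := huv.exists_isPath
  obtain ⟨q, hq⟩ := hvw.exists_isPath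
  obtain ⟨x, r, hr, hxp, hxq, hxr, -⟩ := p.exists_isPath_through_common_vertex hp q hq
  exact ⟨x, hΓ.between_of_mem_support hp hxp, hΓ.between_of_mem_support hq hxq,
    hΓ.between_of_mem_support hr hxr⟩

theorem IsAcyclic.encard_between_le (hΓ : Γ.IsAcyclic) {u v : V} (huv : Γ.Reachable u v) (n : ℕ) :
    {x | Γ.Between u v x ∧ ∃ q : Γ.Walk u x, q.length ≤ n}.encard ≤ (n + 1 : ℕ) := by
  classical
  obtain ⟨p, hp⟩ := huv.exists_isPath
  have hsub : {x | Γ.Between u v x ∧ ∃ q : Γ.Walk u x, q.length ≤ n} ⊆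
      ((Finset.range (n + 1)).image p.getVert : Finset V) := by
    rintro x ⟨hx, q, hq⟩
    have h := congrArg Subtype.val
      ((hΓ.subsingleton_path u x).elim ⟨_, hp.takeUntil (hx p)⟩ q.toPath)
    have hlen : (p.takeUntil x (hx p)).length = q.bypass.length := congrArg Walk.length h
    rw [Finset.coe_image]
    refine ⟨(p.takeUntil x (hx p)).length, ?_, p.getVert_length_takeUntil _⟩
    have := q.length_bypass_le_length
    simp only [Finset.coe_range, Set.mem_Iio]
    omega
  refine (Set.encard_le_encard hsub).trans ?_
  rw [Set.encard_coe_eq_coe_finsetCard]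
  exact_mod_cast Finset.card_image_le.trans (Finset.card_range _).le

end SimpleGraph

section Centroid

open Pointwise

variable {G V : Type*} [Group G] [MulAction G V] {Γ : SimpleGraph V} {S : Set G} {v₀ : V}

theorem SimpleGraph.Between.smul (hadj : ∀ (g : G) u v, Γ.Adj u v → Γ.Adj (g • u) (g • v))
    (g : G) {u v x : V} (h : Γ.Between u v x) : Γ.Between (g • u) (g • v) (g • x) := by
  intro p
  let F : Γ →g Γ := ⟨fun v => g⁻¹ • v, fun h => hadj g⁻¹ _ _ h⟩
  have := h ((p.map F).copy (inv_smul_smul g u) (inv_smul_smul g v))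
  rw [SimpleGraph.Walk.support_copy, SimpleGraph.Walk.support_map, List.mem_map] at this
  obtain ⟨y, hy, hyx⟩ := this
  rwa [← hyx, show F y = g⁻¹ • y from rfl, smul_inv_smul]

theorem exists_orbit_walk (hS : 1 ∈ S)
    (hadj : ∀ (g : G) u v, Γ.Adj u v → Γ.Adj (g • u) (g • v))
    (hstep : ∀ s ∈ S, s • v₀ = v₀ ∨ Γ.Adj v₀ (s • v₀)) (n : ℕ) {y : G} (hy : y ∈ S ^ n) :
    ∃ p : Γ.Walk v₀ (y • v₀), p.length ≤ n ∧ ∀ x ∈ p.support, ∃ g ∈ S ^ n, x = g • v₀ := by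
  induction n generalizing y with
  | zero =>
    obtain rfl : y = 1 := by simpa using hy
    refine ⟨SimpleGraph.Walk.nil.copy rfl (one_smul G v₀).symm, by simp,
      fun x hx => ⟨1, by simp, ?_⟩⟩
    simpa using hx
  | succ n ih =>
    have hmono : S ^ n ⊆ S ^ (n + 1) := Set.pow_subset_pow_right hS n.le_succ
    rw [pow_succ] at hy
    obtain ⟨z, hz, s, hs, rfl⟩ := hy
    obtain ⟨p, hp, hsup⟩ := ih hz
    dsimp only
    rcases hstep s hs with h | h
    · refine ⟨p.copy rfl (by rw [mul_smul, h]), by simp; omega, fun x hx => ?_⟩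
      rw [SimpleGraph.Walk.support_copy] at hx
      obtain ⟨g, hg, rfl⟩ := hsup x hx
      exact ⟨g, hmono hg, rfl⟩
    · have h' : Γ.Adj (z • v₀) ((z * s) • v₀) := by
        rw [mul_smul]
        exact hadj z _ _ h
      refine ⟨p.concat h', by simpa using hp, fun x hx => ?_⟩
      rw [SimpleGraph.Walk.support_concat, List.mem_append,
        List.mem_singleton] at hx
      rcases hx with hx | rfl
      · obtain ⟨g, hg, rfl⟩ := hsup x hx
        exact ⟨g, hmono hg, rfl⟩
      · exact ⟨z * s, by rw [pow_succ]; exact Set.mul_mem_mul hz hs, rfl⟩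

/-- The elements of the `n`-ball which move the base vertex to a vertex between the base vertex
and its image under `x`. -/
def centroidCandidates (Γ : SimpleGraph V) (S : Set G) (v₀ : V) (n : ℕ) (x : G) : Set G :=
  {p | p ∈ S ^ n ∧ Γ.Between v₀ (x • v₀) (p • v₀)}

theorem encard_centroidCandidates_le (hΓ : Γ.IsAcyclic) (hS : 1 ∈ S) (hSinv : S⁻¹ = S)
    (hadj : ∀ (g : G) u v, Γ.Adj u v → Γ.Adj (g • u) (g • v))
    (hstep : ∀ s ∈ S, s • v₀ = v₀ ∨ Γ.Adj v₀ (s • v₀)) {Q : ℕ → ℕ}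
    (hQ : ∀ n, {h | h ∈ S ^ n ∧ h • v₀ = v₀}.encard ≤ Q n) (n : ℕ) {x : G}
    (hx : Γ.Reachable v₀ (x • v₀)) :
    (centroidCandidates Γ S v₀ n x).encard ≤ ((n + 1) * Q (2 * n) : ℕ) := by
  classical
  set U := {v | Γ.Between v₀ (x • v₀) v ∧ ∃ q : Γ.Walk v₀ v, q.length ≤ n} with hU
  have hUcard : U.encard ≤ (n + 1 : ℕ) := hΓ.encard_between_le hx n
  have hUfin : U.Finite := Set.finite_of_encard_le_coe hUcard
  have hmaps : ∀ p ∈ centroidCandidates Γ S v₀ n x, p • v₀ ∈ U := fun p hp => by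
    obtain ⟨q, hq, -⟩ := exists_orbit_walk hS hadj hstep n hp.1
    exact ⟨hp.2, q, hq⟩
  have hfiber : ∀ v, {p ∈ centroidCandidates Γ S v₀ n x | p • v₀ = v}.encard ≤ Q (2 * n) := by
    intro v
    rcases Set.eq_empty_or_nonempty {p ∈ centroidCandidates Γ S v₀ n x | p • v₀ = v} with
      h | ⟨p₀, hp₀, rfl⟩
    · simp [h]
    · refine le_trans ?_ (hQ (2 * n))
      refine Set.encard_le_encard_of_injOn (f := fun p => p₀⁻¹ * p) ?_
        (fun _ _ _ _ h => mul_left_cancel h)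
      rintro p ⟨hp, hpv⟩
      refine ⟨?_, by rw [mul_smul, hpv, inv_smul_smul]⟩
      rw [two_mul, pow_add]
      refine Set.mul_mem_mul ?_ hp.1
      rw [← hSinv, inv_pow, Set.inv_mem_inv]
      exact hp₀.1
  have hfin : (centroidCandidates Γ S v₀ n x).Finite := by
    refine (hUfin.biUnion fun v _ => Set.finite_of_encard_le_coe (hfiber v)).subset fun p hp => ?_
    exact Set.mem_biUnion (hmaps p hp) ⟨hp, rfl⟩
  rw [hfin.encard_eq_coe_toFinset_card, Nat.cast_le]
  have hcard := Finset.card_le_mul_card_image_of_maps_to (s := hfin.toFinset) (t := hUfin.toFinset)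
    (f := fun p => p • v₀) (fun p hp => by simpa using hmaps p (by simpa using hp)) (Q (2 * n))
    (fun v _ => by
      rw [← Nat.cast_le (α := ℕ∞), ← Set.encard_coe_eq_coe_finsetCard]
      refine le_trans (Set.encard_le_encard fun p hp => ?_) (hfiber v)
      simpa using hp)
  have hU' : hUfin.toFinset.card ≤ n + 1 := by
    rwa [hUfin.encard_eq_coe_toFinset_card, Nat.cast_le] at hUcard
  calc _ ≤ Q (2 * n) * hUfin.toFinset.card := hcard
    _ ≤ Q (2 * n) * (n + 1) := Nat.mul_le_mul_left _ hU'
    _ = _ := mul_comm _ _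

theorem exists_centroid (hΓ : Γ.IsAcyclic) (hS : 1 ∈ S) (hSinv : S⁻¹ = S)
    (hadj : ∀ (g : G) u v, Γ.Adj u v → Γ.Adj (g • u) (g • v))
    (hstep : ∀ s ∈ S, s • v₀ = v₀ ∨ Γ.Adj v₀ (s • v₀))
    (hreach : ∀ x : G, Γ.Reachable v₀ (x • v₀)) {n : ℕ} {y : G} (hy : y ∈ S ^ n) (z : G) :
    ∃ p ∈ centroidCandidates Γ S v₀ n y, p ∈ centroidCandidates Γ S v₀ n (y * z) ∧
      y⁻¹ * p ∈ centroidCandidates Γ S v₀ (2 * n) z := by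
  have hyz : Γ.Reachable (y • v₀) ((y * z) • v₀) :=
    (hreach y).symm.trans (hreach (y * z))
  obtain ⟨m, h₁, h₂, h₃⟩ := hΓ.exists_median (hreach y) hyz
  obtain ⟨q, -, hq⟩ := exists_orbit_walk hS hadj hstep n hy
  obtain ⟨p, hp, rfl⟩ := hq m (h₁ q)
  refine ⟨p, ⟨hp, h₁⟩, ⟨hp, h₃⟩, ?_, ?_⟩
  · rw [two_mul, pow_add]
    refine Set.mul_mem_mul ?_ hp
    rwa [← hSinv, inv_pow, Set.inv_mem_inv]
  · have := h₂.smul hadj y⁻¹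
    rwa [inv_smul_smul, mul_smul, inv_smul_smul, ← mul_smul] at this

end Centroid

namespace HNNExtension

open NormalWord

variable {G : Type*} [Group G] {A B : Subgroup G} {φ : A ≃* B}

theorem t_zpow_mul_of (u : ℤˣ) (a : toSubgroup A B u) :
    (t ^ (u : ℤ) * of (a : G) : HNNExtension G A B φ) =
      of (toSubgroupEquiv φ u a : G) * t ^ (u : ℤ) := by
  rcases Int.units_eq_one_or u with rfl | rfl
  · rw [Units.val_one, zpow_one]
    exact t_mul_of a
  · rw [Units.val_neg, Units.val_one, zpow_neg_one]
    exact inv_t_mul_of a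

/-- Left multiplication of a reduced word by a letter `t ^ u` that does not cancel. -/
def NormalWord.ReducedWord.tCons (u : ℤˣ) (w : ReducedWord G A B)
    (h : ∀ b ∈ w.toList.head?, w.head ∈ toSubgroup A B u → u = b.1) : ReducedWord G A B where
  head := 1
  toList := (u, w.head) :: w.toList
  chain := List.isChain_cons.2 ⟨h, w.chain⟩

theorem NormalWord.ReducedWord.prod_tCons (u : ℤˣ) (w : ReducedWord G A B)
    (h : ∀ b ∈ w.toList.head?, w.head ∈ toSubgroup A B u → u = b.1) :
    (w.tCons u h).prod φ = t ^ (u : ℤ) * w.prod φ := by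
  simp [ReducedWord.prod, ReducedWord.tCons, mul_assoc]

/-- Left multiplication of a reduced word by an element of the base group. -/
def NormalWord.ReducedWord.ofMul (g : G) (w : ReducedWord G A B) : ReducedWord G A B :=
  { w with head := g * w.head }

theorem NormalWord.ReducedWord.prod_ofMul (g : G) (w : ReducedWord G A B) :
    (w.ofMul g).prod φ = of g * w.prod φ := by
  simp [ReducedWord.prod, ReducedWord.ofMul, mul_assoc]

theorem t_zpow_notMem_range_of (u : ℤˣ) :
    (t ^ (u : ℤ) : HNNExtension G A B φ) ∉ (of : G →* HNNExtension G A B φ).range := by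
  intro h
  have := ReducedWord.toList_eq_nil_of_mem_of_range φ ((ReducedWord.empty G A B).tCons u (by simp))
    (by rw [ReducedWord.prod_tCons]; simpa [ReducedWord.prod] using h)
  simp [ReducedWord.tCons] at this

section Tree

variable (φ)

/-- The Bass-Serre tree of an HNN extension: the vertices are the cosets of the base group, and
`g` is joined to `g * t` for every `g`. -/
def bassSerreTree :
    SimpleGraph (HNNExtension G A B φ ⧸ (of : G →* HNNExtension G A B φ).range) where
  Adj u v := ∃ (g : HNNExtension G A B φ) (e : ℤˣ), u = g ∧ v = (g * t ^ (e : ℤ) :)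
  symm := ⟨by
    rintro _ _ ⟨g, e, rfl, rfl⟩
    refine ⟨g * t ^ (e : ℤ), -e, rfl, ?_⟩
    simp⟩
  loopless := ⟨by
    rintro _ ⟨g, e, rfl, h⟩
    rw [QuotientGroup.eq, inv_mul_cancel_left] at h
    exact t_zpow_notMem_range_of e h⟩

variable {φ}

theorem bassSerreTree_adj_smul (g : HNNExtension G A B φ)
    (u v : HNNExtension G A B φ ⧸ (of : G →* HNNExtension G A B φ).range)
    (h : (bassSerreTree φ).Adj u v) : (bassSerreTree φ).Adj (g • u) (g • v) := by
  obtain ⟨x, e, rfl, rfl⟩ := h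
  exact ⟨g * x, e, rfl, by rw [mul_assoc]; rfl⟩

theorem bassSerreTree_adj_mk {x : HNNExtension G A B φ}
    {v : HNNExtension G A B φ ⧸ (of : G →* HNNExtension G A B φ).range}
    (h : (bassSerreTree φ).Adj x v) : ∃ (k : G) (e : ℤˣ), v = (x * of k * t ^ (e : ℤ) :) := by
  obtain ⟨g, e, hg, rfl⟩ := h
  rw [QuotientGroup.eq] at hg
  obtain ⟨k, hk⟩ := hg
  exact ⟨k, e, by rw [hk]; simp⟩

theorem mk_mul_of_pinch (x : HNNExtension G A B φ) (u : ℤˣ) {a : G} (ha : a ∈ toSubgroup A B u) :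
    ((x * t ^ (u : ℤ) * of a * t ^ ((-u : ℤˣ) : ℤ) :) :
      HNNExtension G A B φ ⧸ (of : G →* HNNExtension G A B φ).range) = x := by
  rw [mul_assoc x, t_zpow_mul_of u ⟨a, ha⟩, eq_comm, QuotientGroup.eq]
  simp [mul_assoc]

theorem exists_reducedWord_of_isPath
    {u v : HNNExtension G A B φ ⧸ (of : G →* HNNExtension G A B φ).range}
    (p : (bassSerreTree φ).Walk u v) (hp : p.IsPath) (x : HNNExtension G A B φ) (hx : u = x) :
    ∃ w : ReducedWord G A B, v = (x * w.prod φ :) ∧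
      ∀ b ∈ w.toList.head?, p.snd = (x * of w.head * t ^ (b.1 : ℤ) :) := by
  induction p generalizing x with
  | nil => exact ⟨.empty G A B, by simp [hx, ReducedWord.prod], by simp⟩
  | @cons u u' v h p ih =>
    subst hx
    rw [SimpleGraph.Walk.cons_isPath_iff] at hp
    obtain ⟨k, e, hk⟩ := bassSerreTree_adj_mk h
    obtain ⟨w, hw, hsnd⟩ := ih hp.1 _ hk
    have hred : ∀ b ∈ w.toList.head?, w.head ∈ toSubgroup A B e → e = b.1 := by
      intro b hb hmem
      by_contra hne
      have hb1 : b.1 = -e := Int.units_ne_iff_eq_neg.1 (Ne.symm hne)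
      have := hsnd b hb
      rw [hb1, mk_mul_of_pinch _ e hmem] at this
      apply hp.2
      have hk' : ((x * of k : HNNExtension G A B φ) :
          HNNExtension G A B φ ⧸ (of : G →* HNNExtension G A B φ).range) = x := by
        rw [eq_comm, QuotientGroup.eq]
        simp
      rw [← hk', ← this]
      exact p.getVert_mem_support 1
    refine ⟨(w.tCons e hred).ofMul k, ?_, ?_⟩
    · rw [hw, ReducedWord.prod_ofMul, ReducedWord.prod_tCons]
      simp only [mul_assoc]
    · simp [ReducedWord.tCons, ReducedWord.ofMul, hk]

theorem isAcyclic_bassSerreTree : (bassSerreTree φ).IsAcyclic := by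
  intro v c hc
  cases c with
  | nil => simp at hc
  | @cons _ u' _ h p =>
    rw [SimpleGraph.Walk.cons_isCycle_iff] at hc
    obtain ⟨x, e, rfl, hx⟩ := id h
    obtain ⟨w, hw, hsnd⟩ := exists_reducedWord_of_isPath p hc.1 _ hx
    have hred : ∀ b ∈ w.toList.head?, w.head ∈ toSubgroup A B e → e = b.1 := by
      intro b hb hmem
      by_contra hne
      have hb1 : b.1 = -e := Int.units_ne_iff_eq_neg.1 (Ne.symm hne)
      have hs := hsnd b hb
      rw [hb1, mk_mul_of_pinch _ e hmem] at hs
      apply hc.2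
      cases p with
      | nil => exact (h.ne rfl).elim
      | cons h' p' =>
        rw [SimpleGraph.Walk.snd_cons] at hs
        simp [hs, Sym2.eq_swap]
    rw [QuotientGroup.eq, mul_assoc, inv_mul_cancel_left, ← ReducedWord.prod_tCons e w hred] at hw
    have := ReducedWord.toList_eq_nil_of_mem_of_range φ _ hw
    simp [ReducedWord.tCons] at this

theorem reachable_bassSerreTree (x y : HNNExtension G A B φ) :
    (bassSerreTree φ).Reachable
      (x : HNNExtension G A B φ ⧸ (of : G →* HNNExtension G A B φ).range) (x * y :) := by
  induction y using induction_on generalizing x with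
  | of g =>
    have : ((x * of g : HNNExtension G A B φ) :
        HNNExtension G A B φ ⧸ (of : G →* HNNExtension G A B φ).range) = x := by
      rw [eq_comm, QuotientGroup.eq]
      simp
    rw [this]
  | t => exact SimpleGraph.Adj.reachable ⟨x, 1, rfl, by simp⟩
  | mul y z hy hz => exact (hy x).trans (by rw [← mul_assoc]; exact hz (x * y))
  | inv y hy => simpa using (hy (x * y⁻¹)).symm

end Tree

section Weight

variable (ν : G → ℕ)

/-- The element `x` is represented by a reduced word whose syllables from the base group have
total weight at most `m`. -/
def WeightLE (φ : A ≃* B) (x : HNNExtension G A B φ) (m : ℕ) : Prop :=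
  ∃ w : ReducedWord G A B, w.prod φ = x ∧
    ν w.head + (w.toList.map fun b => ν b.2).sum ≤ m

variable {ν}

theorem weightLE_one (hν : ν 1 = 0) : WeightLE ν φ 1 0 :=
  ⟨.empty G A B, by simp [ReducedWord.prod], by simp [hν]⟩

theorem WeightLE.mono {x : HNNExtension G A B φ} {m n : ℕ} (h : WeightLE ν φ x m) (hmn : m ≤ n) :
    WeightLE ν φ x n :=
  let ⟨w, hw, hm⟩ := h
  ⟨w, hw, hm.trans hmn⟩

theorem WeightLE.of_mul (hmul : ∀ g h, ν (g * h) ≤ ν g + ν h) {x : HNNExtension G A B φ} {m : ℕ}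
    (h : WeightLE ν φ x m) (g : G) : WeightLE ν φ (of g * x) (m + ν g) := by
  obtain ⟨w, rfl, hw⟩ := h
  refine ⟨w.ofMul g, w.prod_ofMul g, ?_⟩
  have := hmul g w.head
  simp only [ReducedWord.ofMul]
  omega

theorem WeightLE.t_zpow_mul (hν : ν 1 = 0) (hmul : ∀ g h, ν (g * h) ≤ ν g + ν h)
    (hφ : ∀ a : A, ν (φ a) = ν a) {x : HNNExtension G A B φ} {m : ℕ}
    (h : WeightLE ν φ x m) (u : ℤˣ) : WeightLE ν φ (t ^ (u : ℤ) * x) m := by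
  obtain ⟨w, rfl, hw⟩ := h
  by_cases hred : ∀ b ∈ w.toList.head?, w.head ∈ toSubgroup A B u → u = b.1
  · refine ⟨w.tCons u hred, w.prod_tCons u hred, ?_⟩
    simpa [ReducedWord.tCons, hν] using hw
  · push Not at hred
    obtain ⟨b, hb, hmem, hne⟩ := hred
    obtain ⟨head, toList, chain⟩ := w
    cases toList with
    | nil => simp at hb
    | cons b' l =>
      obtain rfl : b' = b := by simpa using hb
      obtain ⟨e, g⟩ := b'
      obtain rfl : e = -u := Int.units_ne_iff_eq_neg.1 (Ne.symm hne)
      have hφu : ν (toSubgroupEquiv φ u ⟨head, hmem⟩ : G) = ν head := by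
        rcases Int.units_eq_one_or u with rfl | rfl
        · exact hφ ⟨head, hmem⟩
        · have := hφ (φ.symm ⟨head, hmem⟩)
          rw [φ.apply_symm_apply] at this
          exact this.symm
      refine ⟨⟨toSubgroupEquiv φ u ⟨head, hmem⟩ * g, l, (List.isChain_cons.1 chain).2⟩, ?_, ?_⟩
      · have := t_zpow_mul_of (φ := φ) u ⟨head, hmem⟩
        simp only [ReducedWord.prod, List.map_cons, List.prod_cons, ← mul_assoc]
        rw [this]
        simp
      · have := hmul (toSubgroupEquiv φ u ⟨head, hmem⟩) g
        simp only [List.map_cons, List.sum_cons] at hw ⊢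
        omega

theorem WeightLE.of_le {g : G} {m : ℕ} (h : WeightLE ν φ (of g) m) : ν g ≤ m := by
  obtain ⟨w, hw, hm⟩ := h
  have hnil := ReducedWord.toList_eq_nil_of_mem_of_range φ w (by rw [hw]; exact ⟨g, rfl⟩)
  have : w.head = g := by
    apply of_injective (φ := φ)
    rw [← hw]
    simp [ReducedWord.prod, hnil]
  rw [this] at hm
  omega

end Weight

end HNNExtension

section RapidDecay

open scoped ENNReal NNReal

/-- Cauchy-Schwarz for a finite sum whose index set is covered by finitely many pieces. -/
theorem sq_sum_mul_le_card_mul_sum {ι κ : Type*} (s : Finset ι) (t : Finset κ) (α β : ι → ℝ≥0)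
    (R T : ι → κ → Prop) [∀ i k, Decidable (R i k)] [∀ i k, Decidable (T i k)]
    (hcover : ∀ i ∈ s, ∃ k ∈ t, R i k ∧ T i k) :
    (∑ i ∈ s, α i * β i) ^ 2 ≤
      t.card * ∑ k ∈ t, (∑ i ∈ s, if R i k then α i ^ 2 else 0) *
        ∑ i ∈ s, if T i k then β i ^ 2 else 0 := by
  have h₁ : ∑ i ∈ s, α i * β i ≤
      ∑ k ∈ t, ∑ i ∈ s, (if R i k then α i else 0) * (if T i k then β i else 0) := by
    rw [Finset.sum_comm]
    refine Finset.sum_le_sum fun i hi => ?_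
    obtain ⟨k, hk, hR, hT⟩ := hcover i hi
    calc α i * β i = (if R i k then α i else 0) * (if T i k then β i else 0) := by simp [hR, hT]
      _ ≤ _ := Finset.single_le_sum
        (f := fun k => (if R i k then α i else 0) * (if T i k then β i else 0))
        (fun _ _ => zero_le) hk
  calc _ ≤ (∑ k ∈ t, ∑ i ∈ s, (if R i k then α i else 0) * (if T i k then β i else 0)) ^ 2 := by
        gcongr
    _ ≤ t.card * ∑ k ∈ t,
          (∑ i ∈ s, (if R i k then α i else 0) * (if T i k then β i else 0)) ^ 2 :=
        sq_sum_le_card_mul_sum_sq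
    _ ≤ _ := by
        gcongr with k hk
        refine (Finset.sum_mul_sq_le_sq_mul_sq s _ _).trans_eq ?_
        simp only [ite_pow, ne_eq, OfNat.ofNat_ne_zero, not_false_eq_true, zero_pow]

theorem tsum_indicator_const_le {α : Type*} {C : Set α} {D : ℕ} (hC : C.encard ≤ D) (c : ℝ≥0∞) :
    ∑' p, C.indicator (fun _ => c) p ≤ D * c := by
  rw [← tsum_subtype, ENNReal.tsum_const]
  gcongr
  rw [← Set.encard]
  exact_mod_cast hC

/-- The rapid decay inequality from a centroid map with finite ranges. -/
theorem tsum_sq_conv_le_of_centroid {G : Type*} [Group G] (s : Finset G)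
    (f g : G → ℝ≥0) (C₁ C₂ C₃ : G → Set G) {D : ℕ}
    (h₁ : ∀ x, (C₁ x).encard ≤ D) (h₂ : ∀ x, (C₂ x).encard ≤ D) (h₃ : ∀ x, (C₃ x).encard ≤ D)
    (hcentroid : ∀ y ∈ s, ∀ z, ∃ p ∈ C₁ y, p ∈ C₃ (y * z) ∧ y⁻¹ * p ∈ C₂ z) :
    ∑' x, (((∑ y ∈ s, f y * g (y⁻¹ * x)) ^ 2 : ℝ≥0) : ℝ≥0∞) ≤
      (D : ℝ≥0∞) ^ 3 * (∑' y, (f y : ℝ≥0∞) ^ 2) * ∑' z, (g z : ℝ≥0∞) ^ 2 := by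
  classical
  have hfin : ∀ x, (C₃ x).Finite := fun x => Set.finite_of_encard_le_coe (h₃ x)
  have hcard : ∀ x, (hfin x).toFinset.card ≤ D := fun x => by
    have := h₃ x
    rwa [(hfin x).encard_eq_coe_toFinset_card, Nat.cast_le] at this
  set Φ : G → ℝ≥0∞ := fun p => ∑ y ∈ s, (C₁ y).indicator (fun _ => (f y : ℝ≥0∞) ^ 2) p
  set Ψ : G → G → ℝ≥0∞ := fun p x =>
    ∑ y ∈ s, (C₂ (y⁻¹ * x)).indicator (fun _ => (g (y⁻¹ * x) : ℝ≥0∞) ^ 2) (y⁻¹ * p)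
  have hpoint : ∀ x, (((∑ y ∈ s, f y * g (y⁻¹ * x)) ^ 2 : ℝ≥0) : ℝ≥0∞) ≤
      D * ∑' p, Φ p * Ψ p x := by
    intro x
    have := sq_sum_mul_le_card_mul_sum s (hfin x).toFinset f (fun y => g (y⁻¹ * x))
      (fun y p => p ∈ C₁ y) (fun y p => y⁻¹ * p ∈ C₂ (y⁻¹ * x)) (fun y hy => by
        obtain ⟨p, hp₁, hp₃, hp₂⟩ := hcentroid y hy (y⁻¹ * x)
        rw [mul_inv_cancel_left] at hp₃
        exact ⟨p, by simpa using hp₃, hp₁, hp₂⟩)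
    refine (ENNReal.coe_le_coe.2 this).trans ?_
    rw [ENNReal.coe_mul, ENNReal.ofNNReal_finsetSum, ENNReal.coe_natCast]
    refine mul_le_mul' (Nat.cast_le.2 (hcard x)) (le_trans (le_of_eq ?_)
      (ENNReal.sum_le_tsum (hfin x).toFinset))
    refine Finset.sum_congr rfl fun p _ => ?_
    rw [ENNReal.coe_mul, ENNReal.ofNNReal_finsetSum, ENNReal.ofNNReal_finsetSum]
    congr 1 <;> refine Finset.sum_congr rfl fun y _ => ?_ <;>
      · simp only [Set.indicator_apply]
        split_ifs <;> simp
  have hΦ : ∑' p, Φ p ≤ D * ∑' y, (f y : ℝ≥0∞) ^ 2 := by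
    rw [Summable.tsum_finsetSum fun _ _ => ENNReal.summable]
    calc _ ≤ ∑ y ∈ s, D * (f y : ℝ≥0∞) ^ 2 :=
          Finset.sum_le_sum fun y _ => tsum_indicator_const_le (h₁ y) _
      _ ≤ ∑' y, D * (f y : ℝ≥0∞) ^ 2 := ENNReal.sum_le_tsum _
      _ = _ := ENNReal.tsum_mul_left
  have hΨ : ∀ p, ∑' x, Ψ p x ≤ D * ∑' z, (g z : ℝ≥0∞) ^ 2 := by
    intro p
    calc ∑' x, Ψ p x = ∑ y ∈ s, ∑' x,
          (C₂ (y⁻¹ * x)).indicator (fun _ => (g (y⁻¹ * x) : ℝ≥0∞) ^ 2) (y⁻¹ * p) :=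
          Summable.tsum_finsetSum fun _ _ => ENNReal.summable
      _ = ∑ y ∈ s, ∑' z, (C₂ z).indicator (fun _ => (g z : ℝ≥0∞) ^ 2) (y⁻¹ * p) :=
          Finset.sum_congr rfl fun y _ => (Equiv.mulLeft y⁻¹).tsum_eq
            fun z => (C₂ z).indicator (fun _ => (g z : ℝ≥0∞) ^ 2) (y⁻¹ * p)
      _ ≤ ∑' y : G, ∑' z, (C₂ z).indicator (fun _ => (g z : ℝ≥0∞) ^ 2) (y⁻¹ * p) :=
          ENNReal.sum_le_tsum _
      _ = ∑' v : G, ∑' z, (C₂ z).indicator (fun _ => (g z : ℝ≥0∞) ^ 2) v :=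
          ((Equiv.inv G).trans (Equiv.mulRight p)).tsum_eq
            fun v => ∑' z, (C₂ z).indicator (fun _ => (g z : ℝ≥0∞) ^ 2) v
      _ = ∑' z, ∑' v, (C₂ z).indicator (fun _ => (g z : ℝ≥0∞) ^ 2) v := ENNReal.tsum_comm
      _ ≤ ∑' z, D * (g z : ℝ≥0∞) ^ 2 :=
          ENNReal.tsum_le_tsum fun z => tsum_indicator_const_le (h₂ z) _
      _ = _ := ENNReal.tsum_mul_left
  calc _ ≤ ∑' x, D * ∑' p, Φ p * Ψ p x := ENNReal.tsum_le_tsum hpoint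
    _ = D * ∑' p, Φ p * ∑' x, Ψ p x := by
        rw [ENNReal.tsum_mul_left, ENNReal.tsum_comm]
        simp only [ENNReal.tsum_mul_left]
    _ ≤ D * ∑' p, Φ p * (D * ∑' z, (g z : ℝ≥0∞) ^ 2) := by
        gcongr with p
        exact hΨ p
    _ = D * ((∑' p, Φ p) * (D * ∑' z, (g z : ℝ≥0∞) ^ 2)) := by rw [ENNReal.tsum_mul_right]
    _ ≤ D * ((D * ∑' y, (f y : ℝ≥0∞) ^ 2) * (D * ∑' z, (g z : ℝ≥0∞) ^ 2)) := by gcongr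
    _ = _ := by ring

end RapidDecay

namespace WiseGroup

open Multiplicative

/-- The generators of the Wise group. -/
abbrev gen (i : WiseGen) : WiseGroup := PresentedGroup.of i

theorem mk_eq_mk {x y : FreeGroup WiseGen} (h : x * y⁻¹ ∈ wiseRels) :
    PresentedGroup.mk wiseRels x = PresentedGroup.mk wiseRels y :=
  PresentedGroup.mk_eq_mk_of_mul_inv_mem h

theorem c_eq : gen .c = gen .a * gen .b :=
  mk_eq_mk (.inl rfl)

theorem commute_a_b : Commute (gen .a) (gen .b) :=
  mk_eq_mk (.inr (.inl rfl))

theorem c_mul_c_eq_conj_a : gen .c * gen .c = gen .s * gen .a * (gen .s)⁻¹ :=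
  mk_eq_mk (.inr (.inr (.inl rfl)))

theorem c_mul_c_eq_conj_b : gen .c * gen .c = gen .t * gen .b * (gen .t)⁻¹ :=
  mk_eq_mk (.inr (.inr (.inr rfl)))

/-- The homomorphism from the Wise group determined by the images of the generators. -/
def lift {K : Type*} [Group K] (v : WiseGen → K)
    (h₁ : v .c = v .a * v .b) (h₂ : v .a * v .b = v .b * v .a)
    (h₃ : v .c * v .c = v .s * v .a * (v .s)⁻¹)
    (h₄ : v .c * v .c = v .t * v .b * (v .t)⁻¹) : WiseGroup →* K :=
  PresentedGroup.toGroup (f := v) (by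
    rintro r (rfl | rfl | rfl | rfl) <;>
      simp only [map_mul, map_inv, FreeGroup.lift_apply_of, mul_inv_eq_one]
    exacts [h₁, h₂, h₃, h₄])

@[simp]
theorem lift_gen {K : Type*} [Group K] (v : WiseGen → K) (h₁ h₂ h₃ h₄) (i : WiseGen) :
    lift v h₁ h₂ h₃ h₄ (gen i) = v i :=
  PresentedGroup.toGroup.of _

/-- The involution of the generators which exchanges `a` with `b` and `s` with `t`. -/
def swapGen : WiseGen → WiseGen
  | .a => .b
  | .b => .a
  | .c => .c
  | .s => .t
  | .t => .s

/-- The endomorphism of the Wise group which exchanges `a` with `b` and `s` with `t`. -/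
def swapHom : WiseGroup →* WiseGroup :=
  lift (fun i => gen (swapGen i)) (c_eq.trans commute_a_b.eq) commute_a_b.eq.symm
    c_mul_c_eq_conj_b c_mul_c_eq_conj_a

theorem swapHom_gen (i : WiseGen) : swapHom (gen i) = gen (swapGen i) :=
  lift_gen ..

theorem swapHom_comp_swapHom : swapHom.comp swapHom = MonoidHom.id WiseGroup := by
  ext i
  change swapHom (swapHom (gen i)) = gen i
  rw [swapHom_gen, swapHom_gen]
  cases i <;> rfl

/-- The automorphism of the Wise group which exchanges `a` with `b` and `s` with `t`. -/
def swapAut : MulAut WiseGroup :=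
  swapHom.toMulEquiv swapHom swapHom_comp_swapHom swapHom_comp_swapHom

/-- The action of `ℤ` on the Wise group by powers of the exchange automorphism. -/
def swapAction : Multiplicative ℤ →* MulAut WiseGroup :=
  zpowersHom _ swapAut

/-- The exchange of the coordinates of `ℤ²`. -/
def latticeSwap : MulAut (Multiplicative (ℤ × ℤ)) :=
  AddEquiv.toMultiplicative AddEquiv.prodComm

/-- The action of `ℤ` on `ℤ²` by powers of the exchange of the coordinates. -/
def latticeSwapAction : Multiplicative ℤ →* MulAut (Multiplicative (ℤ × ℤ)) :=
  zpowersHom _ latticeSwap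

/-- The group `ℤ² ⋊ ℤ`, where `ℤ` acts by exchanging the coordinates. -/
abbrev Base := Multiplicative (ℤ × ℤ) ⋊[latticeSwapAction] Multiplicative ℤ

/-- The inclusion of `ℤ²`, as the subgroup generated by `a` and `b`, in the Wise group. -/
def latticeHom : Multiplicative (ℤ × ℤ) →* WiseGroup :=
  MonoidHom.mk' (fun q => gen .a ^ q.toAdd.1 * gen .b ^ q.toAdd.2) fun p q => by
    simp only [toAdd_mul, Prod.fst_add, Prod.snd_add, zpow_add]
    exact (commute_a_b.zpow_zpow _ _).mul_mul_mul_comm _ _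

theorem latticeHom_swap (q : Multiplicative (ℤ × ℤ)) :
    latticeHom (latticeSwap q) = swapAut (latticeHom q) := by
  change gen .a ^ q.toAdd.2 * gen .b ^ q.toAdd.1 =
    swapHom (gen .a ^ q.toAdd.1 * gen .b ^ q.toAdd.2)
  rw [map_mul, map_zpow, map_zpow, swapHom_gen, swapHom_gen]
  exact (commute_a_b.zpow_zpow _ _).eq

theorem latticeSwap_mul_self : latticeSwap * latticeSwap = 1 := by
  ext q <;> rfl

theorem swapAut_mul_self : swapAut * swapAut = 1 :=
  MulEquiv.ext fun x => DFunLike.congr_fun swapHom_comp_swapHom x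

theorem latticeSwapAction_eq (n : Multiplicative ℤ) :
    latticeSwapAction n = 1 ∧ swapAction n = 1 ∨
      latticeSwapAction n = latticeSwap ∧ swapAction n = swapAut := by
  change latticeSwap ^ n.toAdd = 1 ∧ swapAut ^ n.toAdd = 1 ∨
    latticeSwap ^ n.toAdd = latticeSwap ∧ swapAut ^ n.toAdd = swapAut
  obtain ⟨k, hk⟩ | ⟨k, hk⟩ := Int.even_or_odd n.toAdd
  · left
    rw [hk, ← two_mul, zpow_mul, zpow_mul, zpow_two, zpow_two, latticeSwap_mul_self,
      swapAut_mul_self, one_zpow, one_zpow]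
    trivial
  · right
    rw [hk, zpow_add_one, zpow_add_one, zpow_mul, zpow_mul, zpow_two, zpow_two,
      latticeSwap_mul_self, swapAut_mul_self, one_zpow, one_zpow, one_mul, one_mul]
    trivial

/-- The homomorphism `ℤ² ⋊ ℤ → G ⋊ ℤ` induced by the inclusion of `ℤ²` in the Wise group `G`. -/
def baseHom : Base →* WiseGroup ⋊[swapAction] Multiplicative ℤ :=
  SemidirectProduct.map latticeHom (.id _) fun n => MonoidHom.ext fun q => by
    obtain ⟨h, h'⟩ | ⟨h, h'⟩ := latticeSwapAction_eq n
    · change latticeHom (latticeSwapAction n q) = swapAction n (latticeHom q)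
      rw [h, h']
      rfl
    · change latticeHom (latticeSwapAction n q) = swapAction n (latticeHom q)
      rw [h, h']
      exact latticeHom_swap q

/-- The embedding of `ℤ` in `ℤ² ⋊ ℤ` whose image is the subgroup generated by `(u, v)`. -/
def baseCyclic (u v : ℤ) : Multiplicative ℤ →* Base :=
  SemidirectProduct.inl.comp
    (MonoidHom.mk' (fun n => ofAdd (u * n.toAdd, v * n.toAdd)) fun m n => by
      simp [mul_add, ← ofAdd_add])

theorem baseCyclic_injective {u : ℤ} (hu : u ≠ 0) (v : ℤ) :
    Function.Injective (baseCyclic u v) := by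
  intro m n h
  have : u * m.toAdd = u * n.toAdd :=
    congrArg (fun x : Base => x.left.toAdd.1) h
  exact toAdd.injective (mul_left_cancel₀ hu this)

/-- The isomorphism of the subgroup generated by `(1, 0)` onto the one generated by `(2, 2)`. -/
noncomputable def baseIso : (baseCyclic 1 0).range ≃* (baseCyclic 2 2).range :=
  ((baseCyclic 1 0).ofInjective (baseCyclic_injective one_ne_zero 0)).symm.trans
    ((baseCyclic 2 2).ofInjective (baseCyclic_injective two_ne_zero 2))

theorem exists_baseIso (x : (baseCyclic 1 0).range) :
    ∃ n, (x : Base) = baseCyclic 1 0 n ∧ (baseIso x : Base) = baseCyclic 2 2 n := by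
  obtain ⟨n, rfl⟩ :=
    ((baseCyclic 1 0).ofInjective (baseCyclic_injective one_ne_zero 0)).surjective x
  refine ⟨n, rfl, ?_⟩
  rw [baseIso, MulEquiv.trans_apply, MulEquiv.symm_apply_apply]
  rfl

/-- An HNN extension of `ℤ² ⋊ ℤ` containing the Wise group. -/
abbrev Hull := HNNExtension Base (baseCyclic 1 0).range (baseCyclic 2 2).range baseIso

/-- The images of the generators of the Wise group in the HNN extension. -/
noncomputable def hullGen : WiseGen → Hull
  | .a => .of (.inl (ofAdd (1, 0)))
  | .b => .of (.inl (ofAdd (0, 1)))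
  | .c => .of (.inl (ofAdd (1, 1)))
  | .s => .t
  | .t => .of (.inr (ofAdd 1)) * .t * (.of (.inr (ofAdd 1)))⁻¹

theorem t_mul_baseCyclic (n : Multiplicative ℤ) :
    HNNExtension.t * HNNExtension.of (baseCyclic 1 0 n) =
      (HNNExtension.of (baseCyclic 2 2 n) * HNNExtension.t : Hull) := by
  obtain ⟨m, h, h'⟩ := exists_baseIso ⟨baseCyclic 1 0 n, n, rfl⟩
  obtain rfl := baseCyclic_injective one_ne_zero 0 h
  rw [← h']
  exact HNNExtension.t_mul_of (φ := baseIso) ⟨baseCyclic 1 0 n, n, rfl⟩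

theorem conj_eq_of_commute {K : Type*} [Group K] {x y z u v : K} (huz : u * z = z * u)
    (hux : u * x = y * u) (hvx : v * x = z * v) : z = u * v * u⁻¹ * y * (u * v * u⁻¹)⁻¹ := by
  have h : u⁻¹ * y = x * u⁻¹ := by
    rw [inv_mul_eq_iff_eq_mul, ← mul_assoc, hux, mul_inv_cancel_right]
  rw [eq_mul_inv_iff_mul_eq, mul_assoc (u * v), h, ← mul_assoc (u * v), mul_assoc u v x, hvx,
    ← mul_assoc, ← mul_assoc, ← mul_assoc, huz]

/-- The homomorphism from the Wise group to the HNN extension. -/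
noncomputable def toHull : WiseGroup →* Hull :=
  lift hullGen (by simp only [hullGen, ← map_mul]; rfl) (by simp only [hullGen, ← map_mul]; rfl)
    (by
      simp only [hullGen, ← map_mul]
      exact eq_mul_inv_of_mul_eq (t_mul_baseCyclic (ofAdd 1)).symm)
    (by
      have h₁ : (SemidirectProduct.inr (ofAdd 1) : Base) * baseCyclic 2 2 (ofAdd 1) =
        baseCyclic 2 2 (ofAdd 1) * SemidirectProduct.inr (ofAdd 1) := rfl
      have h₂ : (SemidirectProduct.inr (ofAdd 1) : Base) * baseCyclic 1 0 (ofAdd 1) =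
        SemidirectProduct.inl (ofAdd (0, 1)) * SemidirectProduct.inr (ofAdd 1) := rfl
      have h₃ := t_mul_baseCyclic (ofAdd 1)
      replace h₁ := congrArg (HNNExtension.of (φ := baseIso)) h₁
      replace h₂ := congrArg (HNNExtension.of (φ := baseIso)) h₂
      rw [map_mul, map_mul] at h₁ h₂
      have hc : hullGen .c * hullGen .c = .of (baseCyclic 2 2 (ofAdd 1)) := by
        simp only [hullGen, ← map_mul]
        rfl
      rw [hc]
      exact conj_eq_of_commute h₁ h₂ h₃)

@[simp]
theorem toHull_gen (i : WiseGen) : toHull (gen i) = hullGen i :=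
  lift_gen ..

theorem latticeHom_ofAdd (m n : ℤ) : latticeHom (ofAdd (m, n)) = gen .a ^ m * gen .b ^ n :=
  rfl

theorem latticeHom_basis_fst : latticeHom (ofAdd (1, 0)) = gen .a := by
  rw [latticeHom_ofAdd, zpow_one, zpow_zero, mul_one]

theorem latticeHom_basis_snd : latticeHom (ofAdd (0, 1)) = gen .b := by
  rw [latticeHom_ofAdd, zpow_one, zpow_zero, one_mul]

theorem latticeHom_one_one : latticeHom (ofAdd (1, 1)) = gen .c := by
  rw [latticeHom_ofAdd, zpow_one, zpow_one, c_eq]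

theorem baseHom_inl (q : Multiplicative (ℤ × ℤ)) : baseHom (.inl q) = .inl (latticeHom q) :=
  SemidirectProduct.map_inl ..

theorem baseHom_inr (n : Multiplicative ℤ) : baseHom (.inr n) = .inr n :=
  SemidirectProduct.map_inr ..

/-- The homomorphism from the HNN extension to `G ⋊ ℤ`, which extends the inclusion of the Wise
group `G`. -/
noncomputable def fromHull : Hull →* WiseGroup ⋊[swapAction] Multiplicative ℤ :=
  HNNExtension.lift baseHom (.inl (gen .s)) fun x => by
    obtain ⟨n, h, h'⟩ := exists_baseIso x
    have h₁ : baseHom (baseCyclic 1 0 (ofAdd 1)) = .inl (gen .a) :=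
      (baseHom_inl _).trans (congrArg _ latticeHom_basis_fst)
    have h₂ : baseHom (baseCyclic 2 2 (ofAdd 1)) = .inl (gen .c * gen .c) := by
      rw [← latticeHom_one_one, ← map_mul]
      exact baseHom_inl _
    have hn : n = ofAdd 1 ^ n.toAdd := by simp [← ofAdd_zsmul]
    rw [h, h', hn, map_zpow, map_zpow, map_zpow, map_zpow, h₁, h₂, ← map_zpow, ← map_zpow,
      c_mul_c_eq_conj_a, conj_zpow, ← map_mul, ← map_mul, inv_mul_cancel_right]

theorem fromHull_toHull (x : WiseGroup) : fromHull (toHull x) = .inl x := by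
  suffices fromHull.comp toHull = SemidirectProduct.inl from DFunLike.congr_fun this x
  refine PresentedGroup.ext fun i => ?_
  change fromHull (toHull (gen i)) = .inl (gen i)
  rw [toHull_gen]
  cases i
  · exact (HNNExtension.lift_of ..).trans ((baseHom_inl _).trans (congrArg _ latticeHom_basis_fst))
  · exact (HNNExtension.lift_of ..).trans ((baseHom_inl _).trans (congrArg _ latticeHom_basis_snd))
  · exact (HNNExtension.lift_of ..).trans ((baseHom_inl _).trans (congrArg _ latticeHom_one_one))
  · exact HNNExtension.lift_t ..
  · have h : swapAction (ofAdd 1) (gen .s) = gen .t := by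
      change (swapAut ^ (1 : ℤ)) (gen .s) = gen .t
      rw [zpow_one]
      exact swapHom_gen .s
    rw [← h, SemidirectProduct.inl_aut]
    simp only [hullGen, fromHull, map_mul, map_inv, HNNExtension.lift_t, HNNExtension.lift_of,
      baseHom_inr]

/-- A length function on `ℤ² ⋊ ℤ`, which takes the same values on `(n, 0)` and on `(2n, 2n)`. -/
def weight (x : Base) : ℕ :=
  3 * (x.left.toAdd.1 - x.left.toAdd.2).natAbs + (x.left.toAdd.1 + x.left.toAdd.2).natAbs

theorem weight_mul_le (x y : Base) : weight (x * y) ≤ weight x + weight y := by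
  unfold weight
  rw [SemidirectProduct.mul_left]
  obtain ⟨h, -⟩ | ⟨h, -⟩ := latticeSwapAction_eq x.right <;> rw [h]
  · change 3 * (x.left.toAdd.1 + y.left.toAdd.1 - (x.left.toAdd.2 + y.left.toAdd.2)).natAbs +
      (x.left.toAdd.1 + y.left.toAdd.1 + (x.left.toAdd.2 + y.left.toAdd.2)).natAbs ≤ _
    omega
  · change 3 * (x.left.toAdd.1 + y.left.toAdd.2 - (x.left.toAdd.2 + y.left.toAdd.1)).natAbs +
      (x.left.toAdd.1 + y.left.toAdd.2 + (x.left.toAdd.2 + y.left.toAdd.1)).natAbs ≤ _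
    omega

theorem weight_inv (x : Base) : weight x⁻¹ = weight x := by
  unfold weight
  rw [SemidirectProduct.inv_left]
  obtain ⟨h, -⟩ | ⟨h, -⟩ := latticeSwapAction_eq x.right⁻¹ <;> rw [h]
  · change 3 * (-x.left.toAdd.1 - -x.left.toAdd.2).natAbs +
      (-x.left.toAdd.1 + -x.left.toAdd.2).natAbs = _
    omega
  · change 3 * (-x.left.toAdd.2 - -x.left.toAdd.1).natAbs +
      (-x.left.toAdd.2 + -x.left.toAdd.1).natAbs = _
    omega

theorem weight_baseIso (x : (baseCyclic 1 0).range) : weight (baseIso x) = weight x := by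
  obtain ⟨n, h, h'⟩ := exists_baseIso x
  rw [h, h']
  change 3 * (2 * n.toAdd - 2 * n.toAdd).natAbs + (2 * n.toAdd + 2 * n.toAdd).natAbs =
    3 * (1 * n.toAdd - 0 * n.toAdd).natAbs + (1 * n.toAdd + 0 * n.toAdd).natAbs
  omega

section Action

open HNNExtension Pointwise

/-- The generators of the Wise group and their inverses, together with the identity. -/
def letters : Set WiseGroup := {1} ∪ wiseGenSet ∪ wiseGenSet⁻¹

theorem one_mem_letters : 1 ∈ letters :=
  .inl (.inl rfl)

theorem inv_letters : letters⁻¹ = letters := by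
  rw [letters, Set.union_inv, Set.union_inv, inv_inv, Set.inv_singleton, inv_one,
    Set.union_right_comm]

theorem toHull_letter {x : WiseGroup} (hx : x ∈ letters) :
    (∃ y, weight y ≤ 4 ∧ toHull x = of y) ∨
      ∃ (y z : Base) (u : ℤˣ), weight y = 0 ∧ weight z = 0 ∧
        toHull x = of y * (t ^ (u : ℤ) * of z) := by
  have key (i : WiseGen) : (∃ y, weight y ≤ 4 ∧ toHull (gen i) = of y) ∨
      ∃ (y z : Base) (u : ℤˣ), weight y = 0 ∧ weight z = 0 ∧
        toHull (gen i) = of y * (t ^ (u : ℤ) * of z) := by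
    rw [toHull_gen]
    cases i
    · exact .inl ⟨_, by decide, rfl⟩
    · exact .inl ⟨_, by decide, rfl⟩
    · exact .inl ⟨_, by decide, rfl⟩
    · exact .inr ⟨1, 1, 1, rfl, rfl, by simp [hullGen]⟩
    · exact .inr ⟨.inr (ofAdd 1), (.inr (ofAdd 1))⁻¹, 1, rfl, rfl,
        by simp [hullGen, mul_assoc]⟩
  obtain (rfl | ⟨i, rfl⟩) | ⟨i, hi⟩ := hx
  · exact .inl ⟨1, by decide, by simp⟩
  · exact key i
  · rw [← inv_inv x, ← hi, map_inv]
    obtain ⟨y, hy, h⟩ | ⟨y, z, u, hy, hz, h⟩ := key i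
    · exact .inl ⟨y⁻¹, (weight_inv y).trans_le hy, by rw [h, map_inv]⟩
    · refine .inr ⟨z⁻¹, y⁻¹, -u, (weight_inv z).trans hz, (weight_inv y).trans hy, ?_⟩
      rw [h]
      simp [mul_assoc]

theorem weightLE_letter_mul {x : WiseGroup} (hx : x ∈ letters) {h : Hull} {m : ℕ}
    (hm : WeightLE weight baseIso h m) : WeightLE weight baseIso (toHull x * h) (m + 4) := by
  obtain ⟨y, hy, hxy⟩ | ⟨y, z, u, hy, hz, hxy⟩ := toHull_letter hx <;> rw [hxy]
  · exact (hm.of_mul weight_mul_le y).mono (by omega)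
  · rw [mul_assoc, mul_assoc]
    exact (((hm.of_mul weight_mul_le z).t_zpow_mul rfl weight_mul_le weight_baseIso u).of_mul
      weight_mul_le y).mono (by omega)

theorem weightLE_of_mem_pow {n : ℕ} {x : WiseGroup} (hx : x ∈ letters ^ n) :
    WeightLE weight baseIso (toHull x) (4 * n) := by
  induction n generalizing x with
  | zero =>
    obtain rfl : x = 1 := by simpa using hx
    rw [map_one]
    exact weightLE_one rfl
  | succ n ih =>
    rw [pow_succ'] at hx
    obtain ⟨y, hy, z, hz, rfl⟩ := hx
    rw [map_mul]
    exact weightLE_letter_mul hy (ih hz)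

/-- The action of the Wise group on the vertices of the Bass–Serre tree of the HNN extension. -/
noncomputable instance treeAction :
    MulAction WiseGroup (Hull ⧸ (of : Base →* Hull).range) :=
  MulAction.compHom _ toHull

theorem smul_mk (x : WiseGroup) (h : Hull) :
    x • (h : Hull ⧸ (of : Base →* Hull).range) = ((toHull x * h : Hull) : Hull ⧸ _) :=
  rfl

theorem adj_smul (x : WiseGroup) (u v : Hull ⧸ (of : Base →* Hull).range)
    (h : (bassSerreTree baseIso).Adj u v) : (bassSerreTree baseIso).Adj (x • u) (x • v) :=
  bassSerreTree_adj_smul (toHull x) u v h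

/-- The base vertex of the Bass–Serre tree. -/
noncomputable def basePoint : Hull ⧸ (of : Base →* Hull).range :=
  ((1 : Hull) : Hull ⧸ _)

theorem smul_basePoint (x : WiseGroup) :
    x • basePoint = ((toHull x : Hull) : Hull ⧸ (of : Base →* Hull).range) := by
  rw [basePoint, smul_mk, mul_one]

theorem smul_basePoint_eq_or_adj {x : WiseGroup} (hx : x ∈ letters) :
    x • basePoint = basePoint ∨ (bassSerreTree baseIso).Adj basePoint (x • basePoint) := by
  rw [smul_basePoint]
  obtain ⟨y, -, hxy⟩ | ⟨y, z, u, -, -, hxy⟩ := toHull_letter hx <;> rw [hxy]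
  · exact .inl (QuotientGroup.eq.mpr ⟨y⁻¹, by simp⟩)
  · refine .inr ⟨of y, u, QuotientGroup.eq.mpr ⟨y, by simp⟩, QuotientGroup.eq.mpr ⟨z⁻¹, ?_⟩⟩
    simp [mul_assoc]

theorem reachable_smul_basePoint (x : WiseGroup) :
    (bassSerreTree baseIso).Reachable basePoint (x • basePoint) := by
  rw [smul_basePoint]
  have := reachable_bassSerreTree (φ := baseIso) 1 (toHull x)
  rwa [one_mul] at this

theorem encard_stabilizer_le (n : ℕ) :
    {x | x ∈ letters ^ n ∧ x • basePoint = basePoint}.encard ≤ ((8 * n + 1) ^ 2 : ℕ) := by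
  have hsub : {x | x ∈ letters ^ n ∧ x • basePoint = basePoint} ⊆
      (fun q : ℤ × ℤ => latticeHom (ofAdd q)) ''
        ((Finset.Icc (-(4 * n) : ℤ) (4 * n) ×ˢ Finset.Icc (-(4 * n) : ℤ) (4 * n) :
          Finset (ℤ × ℤ)) : Set (ℤ × ℤ)) := by
    rintro x ⟨hx, hfix⟩
    rw [smul_basePoint] at hfix
    obtain ⟨y, hy⟩ := QuotientGroup.eq.mp hfix.symm
    rw [inv_one, one_mul] at hy
    have hw := weightLE_of_mem_pow hx
    rw [← hy] at hw
    replace hw := hw.of_le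
    have hxy := fromHull_toHull x
    rw [← hy, fromHull, lift_of] at hxy
    refine ⟨y.left.toAdd, ?_, congrArg SemidirectProduct.left hxy⟩
    unfold weight at hw
    simp only [Finset.coe_product, Finset.coe_Icc, Set.mem_prod, Set.mem_Icc]
    omega
  refine (Set.encard_le_encard hsub).trans ((Set.encard_image_le _ _).trans ?_)
  rw [Set.encard_coe_eq_coe_finsetCard, Finset.card_product, Int.card_Icc, ← sq]
  refine Nat.cast_le.mpr (Nat.pow_le_pow_left ?_ 2)
  omega

theorem list_prod_mem_letters_pow {w : List WiseGroup} (hw : ∀ x ∈ w, x ∈ letters) :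
    w.prod ∈ letters ^ w.length := by
  induction w with
  | nil => simp
  | cons x w ih =>
    rw [List.prod_cons, List.length_cons, pow_succ']
    exact Set.mul_mem_mul (hw x List.mem_cons_self) (ih fun y hy => hw y (.tail _ hy))

theorem mem_letters_pow {x : WiseGroup} {n : ℕ} (hx : wiseWordLength x ≤ n) :
    x ∈ letters ^ n := by
  have hmem : x ∈ Subgroup.closure wiseGenSet := by
    rw [wiseGenSet, PresentedGroup.closure_range_of]
    exact Subgroup.mem_top x
  rw [← Subgroup.mem_toSubmonoid, Subgroup.closure_toSubmonoid] at hmem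
  obtain ⟨w, hw, hwx⟩ := Submonoid.exists_list_of_mem_closure hmem
  obtain ⟨w', hlen, hw', rfl⟩ :=
    Nat.sInf_mem (s := {n | ∃ w : List WiseGroup, w.length = n ∧
      (∀ g ∈ w, g ∈ wiseGenSet ∨ g⁻¹ ∈ wiseGenSet) ∧ w.prod = x}) ⟨_, w, rfl, hw, hwx⟩
  refine Set.pow_subset_pow_right one_mem_letters (hlen.trans_le hx)
    (list_prod_mem_letters_pow fun y hy => ?_)
  exact (hw' y hy).elim (fun h => .inl (.inr h)) .inr

end Action

open scoped ENNReal NNReal Pointwise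

theorem l2norm_eq (h : WiseGroup → ℂ) :
    l2norm h = √(∑' x, (‖h x‖₊ : ℝ≥0∞) ^ 2).toReal := by
  rw [ENNReal.tsum_toReal_eq fun x => by finiteness]
  simp [l2norm]

theorem tsum_sq_nnnorm_ne_top (f : WiseGroup →₀ ℂ) : ∑' x, (‖f x‖₊ : ℝ≥0∞) ^ 2 ≠ ∞ := by
  rw [tsum_eq_sum (s := f.support) fun x hx => by simp [Finsupp.notMem_support_iff.mp hx]]
  exact ENNReal.sum_ne_top.mpr fun x _ => by finiteness

theorem l2norm_conv_le (n : ℕ) (f g : WiseGroup →₀ ℂ)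
    (hf : ∀ x ∈ f.support, wiseWordLength x ≤ n) :
    l2norm (conv f g) ≤ (((2 * n + 1) * (32 * n + 1) ^ 2) ^ 2 : ℕ) *
      l2norm (fun x => f x) * l2norm (fun x => g x) := by
  set D := (2 * n + 1) * (32 * n + 1) ^ 2 with hD
  have hcard (k : ℕ) (hk : k ≤ 2 * n) (x : WiseGroup) :
      (centroidCandidates (HNNExtension.bassSerreTree baseIso) letters basePoint k x).encard ≤
        D := by
    refine (encard_centroidCandidates_le HNNExtension.isAcyclic_bassSerreTree one_mem_letters
      inv_letters adj_smul (fun s hs => smul_basePoint_eq_or_adj hs) encard_stabilizer_le k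
      (reachable_smul_basePoint x)).trans (Nat.cast_le.mpr ?_)
    rw [hD]
    gcongr ?_ * ?_ ^ 2 <;> omega
  have key := tsum_sq_conv_le_of_centroid f.support (fun y => ‖f y‖₊) (fun y => ‖g y‖₊)
    (centroidCandidates (HNNExtension.bassSerreTree baseIso) letters basePoint n)
    (centroidCandidates (HNNExtension.bassSerreTree baseIso) letters basePoint (2 * n))
    (centroidCandidates (HNNExtension.bassSerreTree baseIso) letters basePoint n)
    (hcard n (by omega)) (hcard (2 * n) le_rfl) (hcard n (by omega))
    fun y hy z => exists_centroid HNNExtension.isAcyclic_bassSerreTree one_mem_letters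
      inv_letters adj_smul (fun s hs => smul_basePoint_eq_or_adj hs) reachable_smul_basePoint
      (mem_letters_pow (hf y hy)) z
  have hconv : ∑' x, (‖conv f g x‖₊ : ℝ≥0∞) ^ 2 ≤
      D ^ 3 * (∑' y, (‖f y‖₊ : ℝ≥0∞) ^ 2) * ∑' z, (‖g z‖₊ : ℝ≥0∞) ^ 2 := by
    refine (ENNReal.tsum_le_tsum fun x => ?_).trans key
    rw [← ENNReal.coe_pow]
    refine ENNReal.coe_le_coe.mpr (pow_le_pow_left' ((nnnorm_sum_le _ _).trans ?_) 2)
    exact Finset.sum_le_sum fun y _ => (nnnorm_mul _ _).le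
  replace hconv := ENNReal.toReal_mono (ENNReal.mul_ne_top (ENNReal.mul_ne_top (by finiteness)
    (tsum_sq_nnnorm_ne_top f)) (tsum_sq_nnnorm_ne_top g)) hconv
  rw [ENNReal.toReal_mul, ENNReal.toReal_mul, ENNReal.toReal_pow, ENNReal.toReal_natCast] at hconv
  rw [l2norm_eq, l2norm_eq, l2norm_eq, Real.sqrt_le_iff]
  refine ⟨by positivity, hconv.trans ?_⟩
  rw [mul_pow, mul_pow, Real.sq_sqrt ENNReal.toReal_nonneg, Real.sq_sqrt ENNReal.toReal_nonneg]
  have hD₁ : (1 : ℝ) ≤ D := by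
    rw [hD]
    exact_mod_cast Nat.succ_le_of_lt (by positivity)
  gcongr
  rw [Nat.cast_pow, ← pow_mul]
  exact pow_le_pow_right₀ hD₁ (by norm_num)

end WiseGroup

/-- **Rapid decay for the Wise group.**  There exists a polynomial `P` with real
coefficients such that for every `r ≥ 0` and all finitely supported
`f, g : G → ℂ` with `supp f ⊆ B_r = {x : ℓ(x) ≤ r}` one has
`‖f * g‖₂ ≤ P(r) ‖f‖₂ ‖g‖₂`. -/
theorem wiseGroup_rapid_decay :
    ∃ P : Polynomial ℝ, ∀ r : ℝ, 0 ≤ r → ∀ f g : WiseGroup →₀ ℂ,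
      (∀ x ∈ f.support, (wiseWordLength x : ℝ) ≤ r) →
      l2norm (conv f g) ≤
        P.eval r * l2norm (fun x => f x) * l2norm (fun x => g x) := by
  refine ⟨((2 * .X + 1) * (32 * .X + 1) ^ 2) ^ 2, fun r hr f g hf => ?_⟩
  refine (WiseGroup.l2norm_conv_le ⌊r⌋₊ f g fun x hx => Nat.le_floor (hf x hx)).trans ?_
  have hn : (⌊r⌋₊ : ℝ) ≤ r := Nat.floor_le hr
  unfold l2norm
  gcongr
  simp only [Nat.cast_pow, Nat.cast_mul, Nat.cast_add, Nat.cast_ofNat, Nat.cast_one,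
    Polynomial.eval_pow, Polynomial.eval_mul, Polynomial.eval_add, Polynomial.eval_ofNat,
    Polynomial.eval_X, Polynomial.eval_one]
  gcongr
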